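/- Let G be a simple graph on a finite vertex type V, let c be the number of connected components of G, let |E| be the number of edges of G, and let z be the dimension over ZMod 2 of the kernel of the linear map given by the unoriented incidence matrix of G restricted to columns indexed by edges of G (the 𝔽₂-cycle space of G). Then |V| − |E| = c − z; that is, the Euler characteristic of the graph equals β₀ − β₁. -/

import Mathlib

theorem incMatrix_transpose_ker_iff
    {V : Type*} [Fintype V] [DecidableEq V] (G : SimpleGraph V) [DecidableRel G.Adj]
    (x : V → ZMod 2) :
    (Matrix.transpose (fun (v : V) (e : G.edgeSet) => G.incMatrix (ZMod 2) v e)).mulVec x = 0 ↔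
      ∀ a b, G.Adj a b → x a = x b := by
  have key : ∀ (a b : V) (h : G.Adj a b),
      (Matrix.transpose (fun (v : V) (e : G.edgeSet) => G.incMatrix (ZMod 2) v e)).mulVec x
        ⟨s(a, b), h⟩ = x a + x b := by
    intro a b h
    have h1 : ∀ v : V, G.incMatrix (ZMod 2) v s(a, b) * x v
        = if v ∈ ({a, b} : Finset V) then x v else 0 := by
      intro v
      rw [SimpleGraph.incMatrix_apply']
      simp [SimpleGraph.mk'_mem_incidenceSet_iff, h]
    change ∑ v, G.incMatrix (ZMod 2) v s(a, b) * x v = x a + x b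
    rw [Finset.sum_congr rfl fun v _ => h1 v, Finset.sum_ite_mem, Finset.univ_inter,
      Finset.sum_pair h.ne]
  constructor
  · intro hx a b h
    have := key a b h
    rw [hx] at this
    exact CharTwo.add_eq_zero.mp this.symm
  · intro hx
    funext ⟨e, he⟩
    induction e using Sym2.ind with
    | _ a b =>
      rw [key a b he, hx a b he]
      exact CharTwo.add_self_eq_zero _

theorem finrank_incMatrix_transpose_ker
    {V : Type*} [Fintype V] [DecidableEq V] (G : SimpleGraph V) [DecidableRel G.Adj] :
    Module.finrank (ZMod 2) (LinearMap.ker (Matrix.mulVecLin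
      (Matrix.transpose (fun (v : V) (e : G.edgeSet) => G.incMatrix (ZMod 2) v e))))
      = Nat.card G.ConnectedComponent := by
  classical
  have hr : LinearMap.ker (Matrix.mulVecLin
      (Matrix.transpose (fun (v : V) (e : G.edgeSet) => G.incMatrix (ZMod 2) v e)))
      = LinearMap.range (LinearMap.funLeft (ZMod 2) (ZMod 2) G.connectedComponentMk) := by
    ext x
    rw [LinearMap.mem_ker, Matrix.mulVecLin_apply, incMatrix_transpose_ker_iff]
    constructor
    · intro hx
      refine ⟨fun c => c.lift x ?_, ?_⟩
      · intro v w p _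
        induction p with
        | nil => rfl
        | cons h p ih => exact (hx _ _ h).trans (ih (by simp_all))
      · funext v
        rfl
    · rintro ⟨y, rfl⟩ a b h
      simp only [LinearMap.funLeft_apply]
      rw [SimpleGraph.ConnectedComponent.sound h.reachable]
  rw [hr, LinearMap.finrank_range_of_inj (LinearMap.funLeft_injective_of_surjective _ _ _
    (fun c => c.exists_rep)), Module.finrank_fintype_fun_eq_card, Nat.card_eq_fintype_card]

/-- Euler characteristic of a graph: `|V| − |E| = β₀ − β₁`, where `β₀ = c` is the number of
connected components and `β₁ = z` is the dimension of the `𝔽₂`-cycle space of `G`, i.e. the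
kernel of the unoriented incidence matrix with columns restricted to the edges of `G`. -/
theorem graph_euler_characteristic
    (V : Type*) [Fintype V] [DecidableEq V] (G : SimpleGraph V) [DecidableRel G.Adj] :
    (Fintype.card V : ℤ) - (G.edgeFinset.card : ℤ)
      = (Nat.card G.ConnectedComponent : ℤ)
        - (Module.finrank (ZMod 2)
            (LinearMap.ker
              (Matrix.mulVecLin
                (fun (v : V) (e : G.edgeSet) => G.incMatrix (ZMod 2) v e))) : ℤ) := by
  have h1 := LinearMap.finrank_range_add_finrank_ker
    (Matrix.mulVecLin (fun (v : V) (e : G.edgeSet) => G.incMatrix (ZMod 2) v e))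
  have h2 := LinearMap.finrank_range_add_finrank_ker (Matrix.mulVecLin
    (Matrix.transpose (fun (v : V) (e : G.edgeSet) => G.incMatrix (ZMod 2) v e)))
  have h3 := Matrix.rank_transpose
    (fun (v : V) (e : G.edgeSet) => G.incMatrix (ZMod 2) v e)
  unfold Matrix.rank at h3
  rw [finrank_incMatrix_transpose_ker, Module.finrank_fintype_fun_eq_card] at h2
  rw [Module.finrank_fintype_fun_eq_card] at h1
  rw [SimpleGraph.edgeFinset_card]
  omega
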